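/- arXiv:math/0301372 — 2 statements merged into one kernel-verified Lean document; each statement's English description precedes it below -/
import Mathlib

section
/- Let T be a tree on a finite set I, and let μ denote the Möbius function of the finite lattice L_T ordered by reverse inclusion (whose minimal element is the whole space ℂ^I). Then the characteristic polynomial satisfies Σ_{W ∈ L_T} μ(ℂ^I, W) · y^{dim_ℂ W} = ∏_{i ∈ I} (y − Depth_T(i)) as polynomials in y. -/
/-- A forest on `I`: a partial order on `I` such that the set of elements below any
element is totally ordered (a chain). A *tree* is a forest with a unique minimal
element (the root), see `Forest.IsTree`. -/
structure Forest (I : Type*) where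
  le : I → I → Prop
  le_refl : ∀ i, le i i
  le_trans : ∀ ⦃i j k⦄, le i j → le j k → le i k
  le_antisymm : ∀ ⦃i j⦄, le i j → le j i → i = j
  downset_chain : ∀ ⦃i j k⦄, le j i → le k i → le j k ∨ le k j

namespace Forest

variable {I : Type*}

/-- Strict order associated to a forest. -/
def lt (F : Forest I) (i j : I) : Prop := F.le i j ∧ i ≠ j

/-- A tree is a forest with a (necessarily unique) minimal element lying below
every vertex. -/
def IsTree (T : Forest I) : Prop := ∃ r : I, ∀ i, T.le r i

/-- The depth of a vertex `i`: the number of vertices strictly below `i`. -/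
noncomputable def depth (T : Forest I) (i : I) : ℕ := Nat.card {k : I // T.lt k i}

end Forest

noncomputable section

open scoped Classical

/-- The hyperplane `{x : x_i = x_j}` of `ℂ^I`, as a subspace. -/
def eqSubspace {I : Type*} (i j : I) : Submodule ℂ (I → ℂ) :=
  LinearMap.ker ((LinearMap.proj i : (I → ℂ) →ₗ[ℂ] ℂ) - LinearMap.proj j)

/-- The intersection lattice `L_T` of the arrangement `H_T`: all intersections of
hyperplanes `{x_i = x_j}` with `i <_T j` (the empty intersection being `ℂ^I`,
i.e. the top subspace). -/
def intersectionLattice {I : Type*} [Fintype I] (T : Forest I) :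
    Finset (Submodule ℂ (I → ℂ)) :=
  (Finset.univ.filter (fun p : I × I => T.lt p.1 p.2)).powerset.image
    (fun S => S.inf (fun p => eqSubspace p.1 p.2))

/-- The subspace `⋂_{(i,j) ∈ S} {x : x_i = x_j}` of `ℂ^I`. -/
def intersectionOf {I : Type*} (S : Finset (I × I)) : Submodule ℂ (I → ℂ) :=
  S.inf (fun p => eqSubspace p.1 p.2)

theorem mem_intersectionOf {I : Type*} {S : Finset (I × I)} {x : I → ℂ} :
    x ∈ intersectionOf S ↔ ∀ p ∈ S, x p.1 = x p.2 := by
  simp [intersectionOf, Submodule.mem_finsetInf, eqSubspace, sub_eq_zero]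

/-- The equivalence relation generated by the pairs in `S`. -/
def generatedSetoid {I : Type*} (S : Finset (I × I)) : Setoid I :=
  Relation.EqvGen.setoid (fun i j => (i, j) ∈ S)

/-- Functions equating all pairs in `S` are the functions on the quotient by `S`. -/
theorem forall_eq_iff_mem_range_comp {I α : Type*} (S : Finset (I × I)) (f : I → α) :
    (∀ p ∈ S, f p.1 = f p.2) ↔
      f ∈ Set.range (fun g : Quotient (generatedSetoid S) → α => g ∘ Quotient.mk _) := by
  constructor
  · intro h
    refine ⟨Quotient.lift f fun a b hab => ?_, rfl⟩
    replace hab : Relation.EqvGen (fun i j => (i, j) ∈ S) a b := hab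
    induction hab with
    | rel x y hxy => exact h _ hxy
    | refl x => rfl
    | symm x y _ ih => exact ih.symm
    | trans x y z _ _ ih₁ ih₂ => exact ih₁.trans ih₂
  · rintro ⟨g, rfl⟩ ⟨i, j⟩ hp
    exact congrArg g (Quotient.sound (Relation.EqvGen.rel i j hp))

theorem finrank_intersectionOf {I : Type*} [Fintype I] (S : Finset (I × I)) :
    Module.finrank ℂ (intersectionOf S) = Fintype.card (Quotient (generatedSetoid S)) := by
  have h : intersectionOf S =
      LinearMap.range (LinearMap.funLeft ℂ ℂ (Quotient.mk (generatedSetoid S))) := by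
    ext x
    rw [mem_intersectionOf, forall_eq_iff_mem_range_comp]
    rfl
  rw [h, LinearMap.finrank_range_of_inj
    (LinearMap.funLeft_injective_of_surjective ℂ ℂ _ Quotient.mk_surjective),
    Module.finrank_fintype_fun_eq_card]

theorem card_filter_forall_eq {I : Type*} [Fintype I] (S : Finset (I × I)) (q : ℕ) :
    (Finset.univ.filter (fun f : I → Fin q => ∀ p ∈ S, f p.1 = f p.2)).card
      = q ^ Module.finrank ℂ (intersectionOf S) := by
  have hinj : Function.Injective
      (fun g : Quotient (generatedSetoid S) → Fin q => g ∘ Quotient.mk _) :=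
    Quotient.mk_surjective.injective_comp_right
  rw [finrank_intersectionOf]
  trans (Finset.univ.image
    (fun g : Quotient (generatedSetoid S) → Fin q => g ∘ Quotient.mk _)).card
  · congr 1
    ext f
    simp only [Finset.mem_filter_univ, forall_eq_iff_mem_range_comp, Set.mem_range,
      Finset.mem_image, Finset.mem_univ, true_and]
  · rw [Finset.card_image_of_injective _ hinj]
    simp

/-- The comparable pairs on which a colouring `f` takes the same value. -/
def monochromaticPairs {I : Type*} [Fintype I] (T : Forest I) {q : ℕ} (f : I → Fin q) :
    Finset (I × I) :=
  Finset.univ.filter (fun p : I × I => T.lt p.1 p.2 ∧ f p.1 = f p.2)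

theorem intersectionOf_monochromaticPairs_le_iff {I : Type*} [Fintype I] {T : Forest I} {q : ℕ}
    {S : Finset (I × I)} (hS : ∀ p ∈ S, T.lt p.1 p.2) (f : I → Fin q) :
    intersectionOf (monochromaticPairs T f) ≤ intersectionOf S ↔ ∀ p ∈ S, f p.1 = f p.2 := by
  constructor
  · intro h p hp
    have hf : (fun i => ((f i : ℕ) : ℂ)) ∈ intersectionOf (monochromaticPairs T f) :=
      mem_intersectionOf.2 fun p hp => by
        simp only [(Finset.mem_filter.1 hp).2.2]
    exact Fin.ext (Nat.cast_injective (mem_intersectionOf.1 (h hf) p hp))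
  · intro h x hx
    exact mem_intersectionOf.2 fun p hp =>
      mem_intersectionOf.1 hx p (by simp [monochromaticPairs, hS p hp, h p hp])

theorem mem_intersectionLattice {I : Type*} [Fintype I] {T : Forest I}
    {W : Submodule ℂ (I → ℂ)} :
    W ∈ intersectionLattice T ↔
      ∃ S : Finset (I × I), (∀ p ∈ S, T.lt p.1 p.2) ∧ intersectionOf S = W := by
  simp [intersectionLattice, intersectionOf, Finset.subset_iff]

theorem intersectionOf_monochromaticPairs_eq_top_iff {I : Type*} [Fintype I] {T : Forest I}
    {q : ℕ} (f : I → Fin q) :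
    intersectionOf (monochromaticPairs T f) = ⊤ ↔ ∀ i j, T.lt i j → f i ≠ f j := by
  constructor
  · intro h i j hij hf
    have hx : Pi.single i (1 : ℂ) ∈ intersectionOf (monochromaticPairs T f) := h ▸ trivial
    have := mem_intersectionOf.1 hx (i, j) (by simp [monochromaticPairs, hij, hf])
    simp [hij.2.symm] at this
  · intro h
    refine eq_top_iff.2 fun x _ => mem_intersectionOf.2 fun p hp => ?_
    have hp := (Finset.mem_filter.1 hp).2
    exact absurd hp.2 (h _ _ hp.1)

/-- The colourings `I → Fin q` in which every vertex of `A` has a colour different from those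
of the vertices below it. -/
def properColorings {I : Type*} [Fintype I] (T : Forest I) (q : ℕ) (A : Finset I) :
    Finset (I → Fin q) :=
  Finset.univ.filter (fun f => ∀ j ∈ A, ∀ i, T.lt i j → f i ≠ f j)

theorem mem_properColorings {I : Type*} [Fintype I] {T : Forest I} {q : ℕ} {A : Finset I}
    {f : I → Fin q} :
    f ∈ properColorings T q A ↔ ∀ j ∈ A, ∀ i, T.lt i j → f i ≠ f j := by
  simp [properColorings]

/-- Möbius inversion over the intersection lattice counts proper colourings. -/
theorem sum_mobius_mul_pow_finrank {I : Type*} [Fintype I] (T : Forest I)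
    (μ : Submodule ℂ (I → ℂ) → ℤ)
    (hμ : ∀ W ∈ intersectionLattice T,
      (∑ V ∈ (intersectionLattice T).filter (fun V => W ≤ V), μ V)
        = if W = (⊤ : Submodule ℂ (I → ℂ)) then 1 else 0) (q : ℕ) :
    ∑ W ∈ intersectionLattice T, μ W * (q : ℤ) ^ Module.finrank ℂ W
      = (properColorings T q Finset.univ).card := by
  have hcount : ∀ W ∈ intersectionLattice T, μ W * (q : ℤ) ^ Module.finrank ℂ W =
      ∑ f : I → Fin q, if intersectionOf (monochromaticPairs T f) ≤ W then μ W else 0 := by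
    intro W hW
    obtain ⟨S, hS, rfl⟩ := mem_intersectionLattice.1 hW
    simp_rw [intersectionOf_monochromaticPairs_le_iff hS]
    rw [← Finset.sum_filter, Finset.sum_const, card_filter_forall_eq, nsmul_eq_mul, mul_comm]
    push_cast
    rfl
  rw [Finset.sum_congr rfl hcount, Finset.sum_comm, properColorings, Finset.card_filter,
    Nat.cast_sum]
  refine Finset.sum_congr rfl fun f _ => ?_
  have hmem : intersectionOf (monochromaticPairs T f) ∈ intersectionLattice T :=
    mem_intersectionLattice.2 ⟨_, fun p hp => (Finset.mem_filter.1 hp).2.1, rfl⟩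
  rw [← Finset.sum_filter, hμ _ hmem]
  simp only [intersectionOf_monochromaticPairs_eq_top_iff, Finset.mem_univ, true_imp_iff,
    Nat.cast_ite, Nat.cast_one, Nat.cast_zero]
  exact if_congr forall_comm rfl rfl

theorem Forest.depth_eq_card_filter {I : Type*} [Fintype I] (T : Forest I) (m : I) :
    T.depth m = (Finset.univ.filter (fun k => T.lt k m)).card := by
  rw [Forest.depth, Nat.card_eq_fintype_card, Fintype.card_subtype]

/-- Adding a vertex `m`, all of whose predecessors lie in the down-closed set `A`, to the set of
properly coloured vertices. -/
theorem card_properColorings_insert {I : Type*} [Fintype I] (T : Forest I) (q : ℕ)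
    {A : Finset I} {m : I} (hm : m ∉ A) (hA : ∀ j ∈ A, ∀ i, T.lt i j → i ∈ A)
    (hmA : ∀ i, T.lt i m → i ∈ A) :
    q * (properColorings T q (insert m A)).card
      = (q - T.depth m) * (properColorings T q A).card := by
  let B := Finset.univ.filter (fun k => T.lt k m)
  have hB : ∀ {k}, k ∈ B ↔ T.lt k m := by simp [B]
  have hfree : ∀ g ∈ properColorings T q A,
      (Finset.univ \ B.image g).card = q - T.depth m := by
    intro g hg
    rw [mem_properColorings] at hg
    rw [Finset.card_univ_sdiff, Fintype.card_fin, T.depth_eq_card_filter,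
      Finset.card_image_of_injOn]
    intro a ha b hb hab
    have ha := hB.1 ha
    have hb := hB.1 hb
    by_contra hne
    rcases T.downset_chain ha.1 hb.1 with h | h
    · exact hg b (hmA b hb) a ⟨h, hne⟩ hab
    · exact hg a (hmA a ha) b ⟨h, Ne.symm hne⟩ hab.symm
  have hupd : ∀ (f : I → Fin q) (c : Fin q),
      Function.update f m c ∈ properColorings T q A ↔ f ∈ properColorings T q A := by
    intro f c
    simp only [mem_properColorings]
    refine forall₄_congr fun j hj i hij => ?_
    rw [Function.update_of_ne (ne_of_mem_of_not_mem hj hm),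
      Function.update_of_ne (ne_of_mem_of_not_mem (hA j hj i hij) hm)]
  have hins : ∀ f : I → Fin q, f ∈ properColorings T q (insert m A) ↔
      f ∈ properColorings T q A ∧ ∀ k, T.lt k m → f k ≠ f m := by
    intro f
    simp only [mem_properColorings, Finset.forall_mem_insert]
    exact and_comm
  have hupd_lt : ∀ (f : I → Fin q) (c : Fin q) (k : I), T.lt k m →
      Function.update f m c k = f k := fun f c k hk => Function.update_of_ne hk.2 _ _
  have hcard : (properColorings T q (insert m A) ×ˢ (Finset.univ : Finset (Fin q))).card
      = ((properColorings T q A).sigma (fun g => Finset.univ \ B.image g)).card := by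
    refine Finset.card_bij' (fun p _ => ⟨Function.update p.1 m p.2, p.1 m⟩)
      (fun p _ => (Function.update p.1 m p.2, p.1 m)) ?_ ?_ ?_ ?_
    · rintro ⟨f, c⟩ h
      have h := (hins f).1 (Finset.mem_product.1 h).1
      simp only [Finset.mem_sigma, hupd, h.1, Finset.mem_sdiff, Finset.mem_univ,
        Finset.mem_image, hB, true_and, not_exists, not_and]
      intro k hk
      rw [hupd_lt _ _ _ hk]
      exact h.2 k hk
    · rintro ⟨g, d⟩ h
      simp only [Finset.mem_sigma, Finset.mem_sdiff, Finset.mem_univ,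
        Finset.mem_image, hB, true_and, not_exists, not_and] at h
      simp only [Finset.mem_product, Finset.mem_univ, and_true, hins, hupd, h.1, true_and]
      intro k hk
      rw [hupd_lt _ _ _ hk, Function.update_self]
      exact h.2 k hk
    · rintro ⟨f, c⟩ _
      simp
    · rintro ⟨g, d⟩ _
      simp
  rw [Finset.card_product, Finset.card_univ, Fintype.card_fin, Finset.card_sigma,
    Finset.sum_congr rfl hfree, Finset.sum_const, smul_eq_mul] at hcard
  rw [mul_comm, hcard, mul_comm]

/-- The order of a forest as a `PartialOrder`. -/
abbrev Forest.toPartialOrder {I : Type*} (T : Forest I) : PartialOrder I where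
  le := T.le
  le_refl := T.le_refl
  le_trans _ _ _ h₁ h₂ := T.le_trans h₁ h₂
  le_antisymm _ _ h₁ h₂ := T.le_antisymm h₁ h₂

theorem pow_card_mul_card_properColorings {I : Type*} [Fintype I] (T : Forest I) (q : ℕ)
    (A : Finset I) (hA : ∀ j ∈ A, ∀ i, T.lt i j → i ∈ A) :
    q ^ A.card * (properColorings T q A).card
      = q ^ Fintype.card I * ∏ i ∈ A, (q - T.depth i) := by
  induction A using Finset.strongInduction with
  | H A ih =>
    rcases A.eq_empty_or_nonempty with rfl | hne
    · simp [properColorings]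
    · let := T.toPartialOrder
      obtain ⟨m, hm⟩ := A.exists_maximal hne
      have hmax : ∀ j ∈ A, ¬ T.lt m j := fun j hj h => h.2 (T.le_antisymm h.1 (hm.2 hj h.1))
      have herase : ∀ j ∈ A.erase m, ∀ i, T.lt i j → i ∈ A.erase m := by
        intro j hj i hij
        have hjA := Finset.mem_of_mem_erase hj
        refine Finset.mem_erase.2 ⟨?_, hA j hjA i hij⟩
        rintro rfl
        exact hmax j hjA hij
      have hstep := card_properColorings_insert T q (Finset.notMem_erase m A) herase
        (fun i hi => Finset.mem_erase.2 ⟨hi.2, hA m hm.1 i hi⟩)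
      have hrec := ih _ (Finset.erase_ssubset hm.1) herase
      rw [Finset.insert_erase hm.1] at hstep
      rw [← Finset.card_erase_add_one hm.1, ← Finset.mul_prod_erase A _ hm.1, pow_succ, mul_assoc,
        hstep, mul_left_comm, hrec, mul_left_comm]

theorem card_properColorings_univ {I : Type*} [Fintype I] (T : Forest I) {q : ℕ} (hq : 0 < q) :
    (properColorings T q Finset.univ).card = ∏ i, (q - T.depth i) :=
  Nat.eq_of_mul_eq_mul_left (pow_pos hq (Fintype.card I))
    (pow_card_mul_card_properColorings T q Finset.univ fun _ _ _ _ => Finset.mem_univ _)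

/-- for the Möbius function `μ` of the lattice `L_T` ordered by
reverse inclusion (minimal element `ℂ^I = ⊤`), one has
`Σ_{W ∈ L_T} μ(ℂ^I, W) y^{dim W} = ∏_{i ∈ I} (y - Depth(i))`. The Möbius
function is characterized by `Σ_{V ∈ L_T, V ⊇ W} μ(V) = δ_{W, ℂ^I}`. -/
theorem characteristic_polynomial {I : Type*} [Fintype I] (T : Forest I)
    (hT : T.IsTree) (μ : Submodule ℂ (I → ℂ) → ℤ)
    (hμ : ∀ W ∈ intersectionLattice T,
      (∑ V ∈ (intersectionLattice T).filter (fun V => W ≤ V), μ V)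
        = if W = (⊤ : Submodule ℂ (I → ℂ)) then 1 else 0) :
    (∑ W ∈ intersectionLattice T,
        Polynomial.C (μ W) * Polynomial.X ^ (Module.finrank ℂ W))
      = ∏ i : I, (Polynomial.X - Polynomial.C (T.depth i : ℤ)) := by
  refine Polynomial.eq_of_infinite_eval_eq _ _ ((Set.infinite_range_of_injective
    (f := fun n : ℕ => ((n + Fintype.card I + 1 : ℕ) : ℤ))
    (fun a b h => by simpa using h)).mono ?_)
  rintro _ ⟨n, rfl⟩
  have hdepth : ∀ i, T.depth i ≤ n + Fintype.card I + 1 := fun i => by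
    have := Finset.card_le_univ (Finset.univ.filter (fun k => T.lt k i))
    rw [← T.depth_eq_card_filter] at this
    lia
  simp only [Set.mem_ofPred_eq, Polynomial.eval_finsetSum, Polynomial.eval_prod,
    Polynomial.eval_mul, Polynomial.eval_pow, Polynomial.eval_sub, Polynomial.eval_C,
    Polynomial.eval_X]
  rw [sum_mobius_mul_pow_finrank T μ hμ, card_properColorings_univ T (Nat.succ_pos _),
    Nat.cast_prod]
  exact Finset.prod_congr rfl fun i _ => Nat.cast_sub (hdepth i)

end
end

section
/- Let F and F' be forests on a finite set I. If F' ⊆ F and N(F') = N(F), then F = F' (the orders ≤_F and ≤_{F'} coincide). -/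
namespace Forest

variable {I : Type*}

/-- A root of a forest: a minimal element. -/
def IsRoot (F : Forest I) (r : I) : Prop := ∀ j, F.le j r → j = r

/-- A node of a forest: a vertex which is not a root, i.e. has some vertex
strictly below it. -/
def IsNode (F : Forest I) (i : I) : Prop := ∃ j, F.lt j i

/-- The set `N(F)` of nodes of a forest. -/
def nodes (F : Forest I) : Set I := {i | F.IsNode i}

/-- `i` and `j` lie in the same block of the partition `π(F)` of `I` associated
to `F`, i.e. they lie above a common root. -/
def sameBlock (F : Forest I) (i j : I) : Prop :=
  ∃ r, F.IsRoot r ∧ F.le r i ∧ F.le r j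

/-- The partial order `⊆` on forests: `F' ⊆ F` iff `≤_{F'}` implies `≤_F` and
each tree of `F'` is induced by `F` as a poset (elements of a common block of
`π(F')` that are comparable in `F` are comparable in `F'`). -/
def Sub (F' F : Forest I) : Prop :=
  (∀ i j, F'.le i j → F.le i j) ∧
  (∀ i j, F'.sameBlock i j → F.le i j → F'.le i j)

end Forest

namespace Forest

variable {I : Type*}

theorem isRoot_iff_notMem_nodes (F : Forest I) (r : I) : F.IsRoot r ↔ r ∉ F.nodes := by
  simp [IsRoot, nodes, IsNode, lt]

theorem exists_isRoot_le [Finite I] (F : Forest I) (i : I) : ∃ r, F.IsRoot r ∧ F.le r i := by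
  let _ : PartialOrder I :=
    { le := F.le
      le_refl := F.le_refl
      le_trans := fun _ _ _ hij hjk => F.le_trans hij hjk
      le_antisymm := fun _ _ hij hji => F.le_antisymm hij hji }
  obtain ⟨r, hri, hr⟩ := Set.finite_univ.exists_le_minimal (Set.mem_univ i)
  exact ⟨r, fun j hj => F.le_antisymm hj (hr.2 (Set.mem_univ j) hj), hri⟩

/-- Two roots below a common element coincide. -/
theorem IsRoot.eq_of_le {F : Forest I} {r s i : I} (hr : F.IsRoot r) (hs : F.IsRoot s)
    (hri : F.le r i) (hsi : F.le s i) : r = s :=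
  (F.downset_chain hri hsi).elim (hs r) fun h => (hr s h).symm

end Forest

/-- if `F' ⊆ F` and `N(F') = N(F)` then `F = F'` (the orders `≤_F`
and `≤_{F'}` coincide). -/
theorem eq_of_sub_of_nodes_eq {I : Type*} [Finite I] (F' F : Forest I)
    (h : F'.Sub F) (hN : F'.nodes = F.nodes) :
    ∀ i j, F.le i j ↔ F'.le i j := by
  have root_of_root (r : I) (hr : F'.IsRoot r) : F.IsRoot r := by
    rwa [F.isRoot_iff_notMem_nodes, ← hN, ← F'.isRoot_iff_notMem_nodes]
  refine fun i j => ⟨fun hij => ?_, h.1 i j⟩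
  obtain ⟨r, hr, hri⟩ := F'.exists_isRoot_le i
  obtain ⟨s, hs, hsj⟩ := F'.exists_isRoot_le j
  obtain rfl : r = s :=
    (root_of_root r hr).eq_of_le (root_of_root s hs)
      (F.le_trans (h.1 r i hri) hij) (h.1 s j hsj)
  exact h.2 i j ⟨r, hr, hri, hsj⟩ hij
end
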